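/- If GMC(2n) holds, then Ker(Fₙ) is an MZ space of ℂ[w₁,…,wₙ,z₁,…,zₙ]. -/

import Mathlib

open MeasureTheory ProbabilityTheory

/-- The Gaussian expectation of a complex polynomial in the variables indexed by `σ`,
with respect to the standard Gaussian measure (product of `N(0,1)`'s). -/
noncomputable def gaussExp {σ : Type*} [Fintype σ] (P : MvPolynomial σ ℂ) : ℂ :=
  ∫ x : σ → ℝ, MvPolynomial.eval (fun i => (x i : ℂ)) P
    ∂(Measure.pi fun _ : σ => gaussianReal 0 1)

/-- A Mathieu–Zhao space of a commutative unital `ℂ`-algebra `A`. -/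
def IsMZSpace {A : Type*} [CommRing A] [Algebra ℂ A] (V : Set A) : Prop :=
  (∃ W : Submodule ℂ A, (W : Set A) = V) ∧
    ∀ f : A, (∀ m : ℕ, 1 ≤ m → f ^ m ∈ V) →
      ∀ g : A, ∃ N : ℕ, ∀ m : ℕ, N ≤ m → f ^ m * g ∈ V

/-- The linear map `Eₙ : ℂ[w,z] → ℂ[z]` determined on monomials by
`Eₙ(w^α z^β) = ∂^α (z^β)`. -/
noncomputable def En (n : ℕ) :
    MvPolynomial (Fin n ⊕ Fin n) ℂ →ₗ[ℂ] MvPolynomial (Fin n) ℂ :=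
  (MvPolynomial.basisMonomials (Fin n ⊕ Fin n) ℂ).constr ℂ fun d =>
    (List.finRange n).foldl
      (fun p i => (fun q => MvPolynomial.pderiv i q)^[d (Sum.inl i)] p)
      (MvPolynomial.monomial (Finsupp.equivFunOnFinite.symm fun i => d (Sum.inr i)) 1)

/-- The linear functional `Fₙ : ℂ[w,z] → ℂ`, `Fₙ(P) = Eₙ(P)|_{z=0}`, so that
`Fₙ(w^α z^β) = α!` if `α = β` and `0` otherwise. -/
noncomputable def Fn (n : ℕ) : MvPolynomial (Fin n ⊕ Fin n) ℂ →ₗ[ℂ] ℂ :=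
  (MvPolynomial.aeval (fun _ : Fin n => (0 : ℂ))).toLinearMap.comp (En n)

open MvPolynomial

lemma integrable_ofReal_pow_gaussianReal (k : ℕ) :
    Integrable (fun x : ℝ => (x : ℂ) ^ k) (gaussianReal 0 1) := by
  have h : Integrable (fun x : ℝ => x ^ k) (gaussianReal 0 1) :=
    integrable_pow_of_mem_interior_integrableExpSet (X := id)
      (by simp [integrableExpSet_id_gaussianReal]) k
  simpa using h.ofReal (𝕜 := ℂ)

lemma integral_pow_succ_gaussianReal (k : ℕ) :
    ∫ x, x ^ (k + 1) ∂gaussianReal 0 1 = k * ∫ x, x ^ (k - 1) ∂gaussianReal 0 1 := by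
  have hint (k : ℕ) : Integrable (fun x => x ^ k * gaussianPDFReal 0 1 x) := by
    have h := integrable_rpow_mul_exp_neg_mul_sq (b := 1 / 2) (by norm_num) (s := k)
      (by linarith [Nat.cast_nonneg (α := ℝ) k])
    refine (h.mul_const (√(2 * Real.pi))⁻¹).congr (.of_forall fun x => ?_)
    simp only [gaussianPDFReal, Real.rpow_natCast]
    simp only [NNReal.coe_one, sub_zero, mul_one]
    ring_nf
  have hd (x : ℝ) : HasDerivAt (fun x => x ^ k * gaussianPDFReal 0 1 x)
      (k * (x ^ (k - 1) * gaussianPDFReal 0 1 x) - x ^ (k + 1) * gaussianPDFReal 0 1 x) x := by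
    have h1 : HasDerivAt (gaussianPDFReal 0 1) (-x * gaussianPDFReal 0 1 x) x := by
      have : HasDerivAt (fun x : ℝ => -(x - 0) ^ 2 / (2 * ((1 : NNReal) : ℝ))) (-x) x := by
        have := (((hasDerivAt_id x).sub_const 0).pow 2).neg.div_const (2 * ((1 : NNReal) : ℝ))
        refine this.congr_deriv ?_
        simp
        ring
      refine (this.exp.const_mul (√(2 * Real.pi * ((1 : NNReal) : ℝ)))⁻¹).congr_deriv ?_
      simp only [gaussianPDFReal]
      ring
    refine ((hasDerivAt_pow k x).mul h1).congr_deriv ?_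
    ring
  have h0 := integral_eq_zero_of_hasDerivAt_of_integrable hd
    (((hint (k - 1)).const_mul _).sub (hint (k + 1))) (hint k)
  rw [integral_sub ((hint (k - 1)).const_mul _) (hint (k + 1)), integral_const_mul,
    sub_eq_zero] at h0
  simp only [integral_gaussianReal_eq_integral_smul one_ne_zero, smul_eq_mul]
  simp only [mul_comm (gaussianPDFReal 0 1 _)]
  exact h0.symm

lemma integral_ofReal_pow_succ_gaussianReal (k : ℕ) :
    ∫ x : ℝ, (x : ℂ) ^ (k + 1) ∂gaussianReal 0 1
      = k * ∫ x : ℝ, (x : ℂ) ^ (k - 1) ∂gaussianReal 0 1 := by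
  simp only [← Complex.ofReal_pow, integral_complex_ofReal]
  exact_mod_cast integral_pow_succ_gaussianReal k

section gaussExp

variable {σ : Type*} [Fintype σ]

lemma eval_monomial_eq_prod (d : σ →₀ ℕ) (a : ℂ) (x : σ → ℂ) :
    eval x (monomial d a) = a * ∏ i, x i ^ d i := by
  rw [eval_monomial, Finsupp.prod_fintype _ _ (by simp)]

lemma integrable_eval_gaussian (P : MvPolynomial σ ℂ) :
    Integrable (fun x : σ → ℝ => eval (fun i => (x i : ℂ)) P)
      (Measure.pi fun _ : σ => gaussianReal 0 1) := by
  induction P using MvPolynomial.induction_on' with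
  | monomial d a =>
    simp only [eval_monomial_eq_prod]
    exact (Integrable.fintype_prod
      fun i => integrable_ofReal_pow_gaussianReal (d i)).const_mul a
  | add p q hp hq => exact (hp.add hq).congr (.of_forall fun x => by simp)

/-- The Gaussian expectation as a linear functional. -/
noncomputable def gaussExpLinear (σ : Type*) [Fintype σ] : MvPolynomial σ ℂ →ₗ[ℂ] ℂ where
  toFun := gaussExp
  map_add' P Q := by
    simp only [gaussExp, map_add]
    exact integral_add (integrable_eval_gaussian P) (integrable_eval_gaussian Q)
  map_smul' c P := by
    simp only [gaussExp, smul_eval, RingHom.id_apply, smul_eq_mul]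
    exact integral_const_mul _ _

lemma gaussExpLinear_monomial (d : σ →₀ ℕ) (a : ℂ) :
    gaussExpLinear σ (monomial d a)
      = a * ∏ i, ∫ x : ℝ, (x : ℂ) ^ d i ∂gaussianReal 0 1 := by
  change gaussExp _ = _
  simp only [gaussExp, eval_monomial_eq_prod]
  rw [integral_const_mul,
    integral_fintype_prod_eq_prod (fun i (x : ℝ) => (x : ℂ) ^ d i)]

/-- Gaussian integration by parts for polynomials. -/
lemma gaussExpLinear_X_mul (i : σ) (P : MvPolynomial σ ℂ) :
    gaussExpLinear σ (X i * P) = gaussExpLinear σ (pderiv i P) := by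
  classical
  induction P using MvPolynomial.induction_on' with
  | monomial d a =>
    rw [pderiv_monomial, X, monomial_mul, gaussExpLinear_monomial, gaussExpLinear_monomial,
      ← Finset.mul_prod_erase _ _ (Finset.mem_univ i),
      ← Finset.mul_prod_erase _ _ (Finset.mem_univ i)]
    have h1 : ∀ j ∈ Finset.univ.erase i,
        ∫ x : ℝ, (x : ℂ) ^ (Finsupp.single i 1 + d : σ →₀ ℕ) j ∂gaussianReal 0 1
          = ∫ x : ℝ, (x : ℂ) ^ (d - Finsupp.single i 1 : σ →₀ ℕ) j ∂gaussianReal 0 1 := by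
      intro j hj
      simp [Finsupp.single_eq_of_ne (Finset.ne_of_mem_erase hj)]
    rw [Finset.prod_congr rfl h1]
    have h2 := integral_ofReal_pow_succ_gaussianReal (d i)
    simp only [Finsupp.add_apply, Finsupp.tsub_apply, Finsupp.single_eq_same, add_comm 1]
    rw [h2]
    ring
  | add p q hp hq => simp [mul_add, hp, hq]

end gaussExp

section Fn

variable {n : ℕ}

lemma iterate_pderiv_monomial {σ : Type*} (i : σ) (k : ℕ) (s : σ →₀ ℕ) (a : ℂ) :
    (fun q => pderiv i q)^[k] (monomial s a)
      = monomial (s - Finsupp.single i k) (a * (s i).descFactorial k) := by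
  induction k with
  | zero => simp
  | succ k ih =>
    rw [Function.iterate_succ_apply', ih, pderiv_monomial, tsub_tsub, ← Finsupp.single_add]
    congr 1
    simp [Nat.descFactorial_succ]
    ring

lemma foldl_iterate_pderiv_monomial {σ : Type*} [DecidableEq σ] (e : σ → ℕ) (l : List σ)
    (hl : l.Nodup) (s : σ →₀ ℕ) (a : ℂ) :
    l.foldl (fun p i => (fun q => pderiv i q)^[e i] p) (monomial s a)
      = monomial (s - ∑ i ∈ l.toFinset, Finsupp.single i (e i))
          (a * ∏ i ∈ l.toFinset, ((s i).descFactorial (e i) : ℂ)) := by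
  induction l generalizing s a with
  | nil => simp
  | cons i l ih =>
    obtain ⟨hi, hl⟩ := List.nodup_cons.mp hl
    have hi' : i ∉ l.toFinset := by simpa using hi
    rw [List.foldl_cons, iterate_pderiv_monomial, ih hl, List.toFinset_cons,
      Finset.sum_insert hi', Finset.prod_insert hi', tsub_tsub, mul_assoc]
    congr 3
    refine Finset.prod_congr rfl fun j hj => ?_
    have : j ≠ i := fun h => hi' (h ▸ hj)
    simp [Finsupp.single_eq_of_ne this]

lemma Fn_monomial (d : Fin n ⊕ Fin n →₀ ℕ) (a : ℂ) :
    Fn n (monomial d a) = a * ∏ i,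
      if d (Sum.inl i) = d (Sum.inr i) then ((d (Sum.inl i)).factorial : ℂ) else 0 := by
  have ha : monomial d a = a • basisMonomials (Fin n ⊕ Fin n) ℂ d := by
    simp [smul_monomial]
  rw [ha, map_smul, smul_eq_mul]
  congr 1
  rw [Fn, LinearMap.comp_apply, En, Module.Basis.constr_basis, foldl_iterate_pderiv_monomial _ _
    (List.nodup_finRange n)]
  have hu : (List.finRange n).toFinset = Finset.univ := by ext; simp
  rw [hu, one_mul, AlgHom.toLinearMap_apply, aeval_monomial,
    Finsupp.prod_fintype _ _ (by simp)]
  simp only [Algebra.algebraMap_self, RingHom.id_apply, ← Finset.prod_mul_distrib]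
  refine Finset.prod_congr rfl fun i _ => ?_
  have hs : (∑ j, Finsupp.single j (d (Sum.inl j))) i = d (Sum.inl i) := by
    simp [Finsupp.finsetSum_apply, Finsupp.single_apply]
  simp only [Finsupp.tsub_apply, hs, Finsupp.equivFunOnFinite_symm_apply_apply]
  rcases lt_trichotomy (d (Sum.inl i)) (d (Sum.inr i)) with h | h | h
  · simp [h.ne, (Nat.sub_pos_of_lt h).ne']
  · simp [h, Nat.descFactorial_self]
  · simp [h.ne', Nat.descFactorial_eq_zero_iff_lt.mpr h]

lemma ite_succ_eq_factorial (p q : ℕ) :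
    (if p + 1 = q then ((p + 1).factorial : ℂ) else 0)
      = q * if p = q - 1 then (p.factorial : ℂ) else 0 := by
  cases q <;> simp [Nat.factorial_succ]
  grind

lemma ite_eq_succ_factorial (p q : ℕ) :
    (if p = q + 1 then (p.factorial : ℂ) else 0)
      = p * if p - 1 = q then ((p - 1).factorial : ℂ) else 0 := by
  cases p <;> simp [Nat.factorial_succ]

/-- Multiplication by a variable is adjoint under `Fn` to differentiation in the conjugate
variable. -/
lemma Fn_X_mul (s : Fin n ⊕ Fin n) (P : MvPolynomial (Fin n ⊕ Fin n) ℂ) :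
    Fn n (X s * P) = Fn n (pderiv s.swap P) := by
  classical
  induction P using MvPolynomial.induction_on' with
  | monomial d a =>
    rw [pderiv_monomial, X, monomial_mul, Fn_monomial, Fn_monomial]
    rcases s with i | i
    all_goals
      rw [← Finset.mul_prod_erase _ _ (Finset.mem_univ i),
        ← Finset.mul_prod_erase _ _ (Finset.mem_univ i), one_mul, mul_assoc, ← mul_assoc (d _ : ℂ)]
      congr 2
      · simp only [Finsupp.add_apply, Finsupp.tsub_apply, Finsupp.single_apply, Sum.swap_inl,
          Sum.swap_inr, if_true, reduceCtorEq, if_false, zero_add, tsub_zero]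
        simp only [add_comm 1]
        first
        | exact ite_succ_eq_factorial _ _
        | exact ite_eq_succ_factorial _ _
      · refine Finset.prod_congr rfl fun j hj => ?_
        have := Finset.ne_of_mem_erase hj
        simp [this.symm]
  | add p q hp hq => simp [mul_add, hp, hq]

end Fn

/-- A linear functional intertwining multiplication by each variable with differentiation in an
associated variable is determined by its value at `1`. -/
lemma linearMap_eq_of_X_mul_eq_pderiv {σ : Type*} (τ : σ → σ) {S T : MvPolynomial σ ℂ →ₗ[ℂ] ℂ}
    (h1 : S 1 = T 1) (hS : ∀ s P, S (X s * P) = S (pderiv (τ s) P))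
    (hT : ∀ s P, T (X s * P) = T (pderiv (τ s) P)) : S = T := by
  classical
  have key (k : ℕ) : ∀ (d : σ →₀ ℕ) (a : ℂ), d.degree = k →
      S (monomial d a) = T (monomial d a) := by
    induction k using Nat.strong_induction_on with
    | _ k ih =>
      intro d a hk
      by_cases hd : d = 0
      · have : monomial d a = a • (1 : MvPolynomial σ ℂ) := by
          rw [hd, ← C_apply, smul_eq_C_mul, mul_one]
        rw [this, map_smul, map_smul, h1]
      · obtain ⟨s, hs⟩ := Finsupp.ne_iff.mp hd
        have hle : Finsupp.single s 1 ≤ d := by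
          simpa [Nat.one_le_iff_ne_zero] using hs
        obtain ⟨e, rfl⟩ := exists_add_of_le hle
        have : monomial (Finsupp.single s 1 + e) a = X s * monomial e a := by
          rw [X, monomial_mul, one_mul]
        rw [this, hS, hT, pderiv_monomial]
        refine ih _ ?_ _ _ rfl
        have : (e - Finsupp.single (τ s) 1).degree ≤ e.degree :=
          Finsupp.degree_mono tsub_le_self
        simp only [map_add, Finsupp.degree_single] at hk
        omega
  ext d
  exact key _ d 1 rfl

section complexCoords

variable {n : ℕ}

/-- The substitution `wᵢ ↦ c (xᵢ + i yᵢ)`, `zᵢ ↦ c (xᵢ - i yᵢ)`. -/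
noncomputable def complexCoords (n : ℕ) (c : ℂ) :
    MvPolynomial (Fin n ⊕ Fin n) ℂ →ₐ[ℂ] MvPolynomial (Fin n ⊕ Fin n) ℂ :=
  aeval (Sum.elim
    (fun i => c • (X (Sum.inl i) + Complex.I • X (Sum.inr i)))
    (fun i => c • (X (Sum.inl i) - Complex.I • X (Sum.inr i))))

lemma complexCoords_X_inl (c : ℂ) (i : Fin n) :
    complexCoords n c (X (Sum.inl i)) = c • (X (Sum.inl i) + Complex.I • X (Sum.inr i)) := by
  simp [complexCoords]

lemma complexCoords_X_inr (c : ℂ) (i : Fin n) :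
    complexCoords n c (X (Sum.inr i)) = c • (X (Sum.inl i) - Complex.I • X (Sum.inr i)) := by
  simp [complexCoords]

/-- The chain rule for a derivation along a substitution, from its values on the variables. -/
lemma derivation_algHom_eq_algHom_pderiv {σ τ : Type*} [DecidableEq σ]
    (D : Derivation ℂ (MvPolynomial τ ℂ) (MvPolynomial τ ℂ))
    (φ : MvPolynomial σ ℂ →ₐ[ℂ] MvPolynomial τ ℂ) (s : σ)
    (h : ∀ t, D (φ (X t)) = if t = s then 1 else 0) (P : MvPolynomial σ ℂ) :
    D (φ P) = φ (pderiv s P) := by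
  induction P using MvPolynomial.induction_on with
  | C a => simp [← algebraMap_eq]
  | add p q hp hq => simp [hp, hq]
  | mul_X p t hp =>
    rw [map_mul, Derivation.leibniz, Derivation.leibniz, hp, h t, pderiv_X]
    by_cases hts : t = s <;> simp [hts]

lemma gaussExpLinear_complexCoords_X_mul {c : ℂ} (hc : c * c = 1 / 2) (s : Fin n ⊕ Fin n)
    (P : MvPolynomial (Fin n ⊕ Fin n) ℂ) :
    gaussExpLinear _ (complexCoords n c (X s * P))
      = gaussExpLinear _ (complexCoords n c (pderiv s.swap P)) := by
  have hI : C Complex.I * C Complex.I = (-1 : MvPolynomial (Fin n ⊕ Fin n) ℂ) := by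
    rw [← C_mul, Complex.I_mul_I]; simp
  have hC : 2 * (C c * C c) = (1 : MvPolynomial (Fin n ⊕ Fin n) ℂ) := by
    rw [← C_mul, hc, show (2 : MvPolynomial (Fin n ⊕ Fin n) ℂ) = C 2 from rfl, ← C_mul]
    norm_num
  rcases s with i | i
  · rw [Sum.swap_inl, ← derivation_algHom_eq_algHom_pderiv
      (c • (pderiv (Sum.inl i) + Complex.I • pderiv (Sum.inr i)))]
    · simp [complexCoords_X_inl, add_mul, gaussExpLinear_X_mul]
    · rintro (j | j)
      all_goals
        simp only [complexCoords_X_inl, complexCoords_X_inr, Derivation.smul_apply,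
          Derivation.add_apply, Sum.inr.injEq, reduceCtorEq, if_false, smul_eq_C_mul]
        by_cases hij : j = i <;> (simp [hij]; try grind)
  · rw [Sum.swap_inr, ← derivation_algHom_eq_algHom_pderiv
      (c • (pderiv (Sum.inl i) - Complex.I • pderiv (Sum.inr i)))]
    · simp [complexCoords_X_inr, sub_mul, gaussExpLinear_X_mul]
    · rintro (j | j)
      all_goals
        simp only [complexCoords_X_inl, complexCoords_X_inr, Derivation.smul_apply,
          Derivation.sub_apply, Sum.inl.injEq, reduceCtorEq, if_false, smul_eq_C_mul]
        by_cases hij : j = i <;> (simp [hij]; try grind)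

lemma gaussExp_complexCoords {c : ℂ} (hc : c * c = 1 / 2)
    (P : MvPolynomial (Fin n ⊕ Fin n) ℂ) : gaussExp (complexCoords n c P) = Fn n P := by
  have h : (gaussExpLinear _).comp (complexCoords n c).toLinearMap = Fn n := by
    refine linearMap_eq_of_X_mul_eq_pderiv Sum.swap ?_
      (gaussExpLinear_complexCoords_X_mul hc) Fn_X_mul
    have h1 := Fn_monomial (n := n) 0 1
    have h2 := gaussExpLinear_monomial (σ := Fin n ⊕ Fin n) 0 1
    rw [← C_apply, C_1] at h1 h2
    simp [h1, h2]
  exact LinearMap.congr_fun h P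

end complexCoords

/-- if `GMC(2n)` holds (here stated with the `2n` variables indexed by
`Fin n ⊕ Fin n`), then `Ker Fₙ` is an MZ space of `ℂ[w,z]`. -/
theorem gmc2n_implies_ker_Fn_MZ (n : ℕ)
    (h : ∀ P : MvPolynomial (Fin n ⊕ Fin n) ℂ,
      (∀ m : ℕ, 1 ≤ m → gaussExp (P ^ m) = 0) →
      ∀ Q : MvPolynomial (Fin n ⊕ Fin n) ℂ,
        ∃ N : ℕ, ∀ m : ℕ, N ≤ m → gaussExp (P ^ m * Q) = 0) :
    IsMZSpace (↑(LinearMap.ker (Fn n)) : Set (MvPolynomial (Fin n ⊕ Fin n) ℂ)) := by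
  obtain ⟨c, hc⟩ := IsAlgClosed.exists_eq_mul_self (1 / 2 : ℂ)
  have hF := gaussExp_complexCoords (n := n) hc.symm
  refine ⟨⟨_, rfl⟩, fun f hf g => ?_⟩
  simp only [SetLike.mem_coe, LinearMap.mem_ker, ← hF, map_pow, map_mul] at hf ⊢
  exact h _ hf _
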